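/- arXiv:1812.03077 — 4 statements merged into one kernel-verified Lean document; each statement's English description precedes it below -/
import Mathlib

section
/- Let φ : [0,∞) → [0,∞) be nondecreasing with φ(x) → ∞ as x → ∞, and assume there exist ε > 0 and η > 0 such that φ(x) ≥ ηx for all 0 ≤ x < ε. Then for every C ≥ 0 there exists η̂ > 0 such that: for every sequence (σ_i)_{i∈ℕ} of nonnegative real numbers satisfying φ(σ_i) ≤ C for all i, one has ∑_{i=1}^∞ φ(σ_i) ≥ η̂ · ∑_{i=1}^∞ σ_i (as an inequality in [0,∞]). -/
/-- Let `φ : [0,∞) → [0,∞)` be nondecreasing with `φ(x) → ∞` as `x → ∞`,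
and suppose `φ(x) ≥ ηx` for `0 ≤ x < ε` (some `ε, η > 0`). Then for every `C ≥ 0` there is
`η̂ > 0` such that every nonnegative sequence `(σ_i)` with `φ(σ_i) ≤ C` for all `i` satisfies
`∑ φ(σ_i) ≥ η̂ ∑ σ_i` in `[0,∞]`. -/
theorem stmt5 (φ : ℝ → ℝ)
    (hmono : MonotoneOn φ (Set.Ici 0)) (hnn : ∀ x, 0 ≤ x → 0 ≤ φ x)
    (htop : Filter.Tendsto φ Filter.atTop Filter.atTop)
    (ε η : ℝ) (hε : 0 < ε) (hη : 0 < η)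
    (hlin : ∀ x, 0 ≤ x → x < ε → η * x ≤ φ x)
    (C : ℝ) (hC : 0 ≤ C) :
    ∃ η' : ℝ, 0 < η' ∧
      ∀ σ : ℕ → ℝ, (∀ i, 0 ≤ σ i) → (∀ i, φ (σ i) ≤ C) →
        ENNReal.ofReal η' * ∑' i, ENNReal.ofReal (σ i) ≤
          ∑' i, ENNReal.ofReal (φ (σ i)) := by
  obtain ⟨M₀, hM₀⟩ := Filter.eventually_atTop.1 (htop.eventually_gt_atTop C)
  set M := max M₀ 1 with hM
  have hMpos : 0 < M := lt_of_lt_of_le one_pos (le_max_right _ _)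
  have hpos : 0 < min η (η * (ε / 2) / M) := lt_min hη (by positivity)
  refine ⟨min η (η * (ε / 2) / M), hpos, fun σ h0 hσ => ?_⟩
  rw [← ENNReal.tsum_mul_left]
  refine ENNReal.tsum_le_tsum fun i => ?_
  rw [← ENNReal.ofReal_mul hpos.le]
  apply ENNReal.ofReal_le_ofReal
  have hlt : σ i < M := by
    by_contra hcon
    have h1 := hM₀ (σ i) (le_trans (le_max_left _ _) (not_lt.1 hcon))
    linarith [hσ i]
  rcases lt_or_ge (σ i) ε with h | h
  · exact le_trans (mul_le_mul_of_nonneg_right (min_le_left _ _) (h0 i)) (hlin _ (h0 i) h)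
  · have h2 : φ (ε / 2) ≤ φ (σ i) :=
      hmono (Set.mem_Ici.2 (by linarith)) (Set.mem_Ici.2 (h0 i)) (by linarith)
    have h3 := hlin (ε / 2) (by linarith) (by linarith)
    calc min η (η * (ε / 2) / M) * σ i ≤ (η * (ε / 2) / M) * M :=
          mul_le_mul (min_le_right _ _) hlt.le (h0 i) (by positivity)
      _ = η * (ε / 2) := div_mul_cancel₀ _ hMpos.ne'
      _ ≤ φ (σ i) := h3.trans h2
end

section
/- Fix parameters 0 < δ < 1 and ε > 0 and define φ : [0,∞) → [0,∞) by φ(x) = x − εδx² for 0 ≤ x ≤ 1/(2ε) and φ(x) = (1−δ)x + δ/(4ε) for x > 1/(2ε). Let τ, ρ > 0 satisfy 2εδτρ < 1 and let x₀ ≥ 0. Then the function x ↦ (x − x₀)²/(2τ) + ρφ(|x|) on ℝ has a unique minimizer, given by: 0 if 0 ≤ x₀ ≤ τρ; (x₀ − τρ)/(1 − 2εδτρ) if τρ < x₀ ≤ 1/(2ε) + τρ(1−δ); and x₀ − τρ(1−δ) if x₀ > 1/(2ε) + τρ(1−δ). -/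
/-- The semi-convex potential `φ(x) = x − εδx²` for `0 ≤ x ≤ 1/(2ε)`,
`φ(x) = (1−δ)x + δ/(4ε)` for `x > 1/(2ε)`. -/
noncomputable def phiSC (ε δ : ℝ) (x : ℝ) : ℝ :=
  if x ≤ 1 / (2 * ε) then x - ε * δ * x ^ 2 else (1 - δ) * x + δ / (4 * ε)

theorem phi_lo (ε δ p t : ℝ) (hδ0 : 0 < δ) (hε : 0 < ε) (hp : p ≤ 1 / (2 * ε)) :
    phiSC ε δ p + (1 - 2 * ε * δ * p) * (t - p) - ε * δ * (t - p) ^ 2 ≤ phiSC ε δ t := by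
  unfold phiSC
  rw [if_pos hp]
  split_ifs with h
  · apply le_of_eq; ring
  · have : (1 - δ) * t + δ / (4 * ε) = t - ε * δ * t ^ 2 + ε * δ * (t - 1 / (2 * ε)) ^ 2 := by
      field_simp; ring
    rw [this]
    have : 0 ≤ ε * δ * (t - 1 / (2 * ε)) ^ 2 := by positivity
    nlinarith

theorem phi_hi (ε δ p t : ℝ) (hδ0 : 0 < δ) (hε : 0 < ε) (hp : 1 / (2 * ε) < p) :
    phiSC ε δ p + (1 - δ) * (t - p) - ε * δ * (t - p) ^ 2 ≤ phiSC ε δ t := by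
  unfold phiSC
  rw [if_neg (not_le.2 hp)]
  split_ifs with h
  · have : t - ε * δ * t ^ 2 = (1 - δ) * p + δ / (4 * ε) + (1 - δ) * (t - p)
        - ε * δ * (t - p) ^ 2 + ε * δ * ((p - 1 / (2 * ε)) * (p + 1 / (2 * ε) - 2 * t)) := by
      field_simp; ring
    rw [this]
    have h1 : 0 ≤ p - 1 / (2 * ε) := by linarith
    have h2 : 0 ≤ p + 1 / (2 * ε) - 2 * t := by linarith
    have : 0 ≤ ε * δ * ((p - 1 / (2 * ε)) * (p + 1 / (2 * ε) - 2 * t)) := by positivity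
    linarith
  · have : 0 ≤ ε * δ * (t - p) ^ 2 := by positivity
    linarith

theorem key (ε δ τ ρ x₀ p g : ℝ) (hδ0 : 0 < δ) (hε : 0 < ε) (hτ : 0 < τ) (hρ : 0 < ρ)
    (hsmall : 2 * ε * δ * τ * ρ < 1) (hp : 0 ≤ p)
    (hφ : ∀ t, phiSC ε δ p + g * (t - p) - ε * δ * (t - p) ^ 2 ≤ phiSC ε δ t)
    (ho : ∀ y, 0 ≤ (y - p) * (p - x₀) + τ * ρ * g * (|y| - p)) :
    (∀ y : ℝ, (p - x₀) ^ 2 / (2 * τ) + ρ * phiSC ε δ |p| ≤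
        (y - x₀) ^ 2 / (2 * τ) + ρ * phiSC ε δ |y|) ∧
    (∀ x : ℝ, (∀ y : ℝ, (x - x₀) ^ 2 / (2 * τ) + ρ * phiSC ε δ |x| ≤
          (y - x₀) ^ 2 / (2 * τ) + ρ * phiSC ε δ |y|) → x = p) := by
  have main : ∀ y : ℝ, (p - x₀) ^ 2 / (2 * τ) + ρ * phiSC ε δ |p|
      + (1 - 2 * ε * δ * τ * ρ) / (2 * τ) * (y - p) ^ 2 ≤
        (y - x₀) ^ 2 / (2 * τ) + ρ * phiSC ε δ |y| := by
    intro y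
    rw [abs_of_nonneg hp]
    have h1 := mul_le_mul_of_nonneg_left (hφ |y|) hρ.le
    have h2 : (|y| - p) ^ 2 ≤ (y - p) ^ 2 := by
      nlinarith [sq_abs y, mul_le_mul_of_nonneg_right (le_abs_self y) hp]
    have h3 := mul_le_mul_of_nonneg_left h2 (by positivity : 0 ≤ ρ * (ε * δ))
    have h4 := div_nonneg (ho y) hτ.le
    have h5 : (y - x₀) ^ 2 / (2 * τ) = (p - x₀) ^ 2 / (2 * τ)
      + (1 - 2 * ε * δ * τ * ρ) / (2 * τ) * (y - p) ^ 2 + ρ * (ε * δ) * (y - p) ^ 2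
      + ((y - p) * (p - x₀) + τ * ρ * g * (|y| - p)) / τ - ρ * g * (|y| - p) := by
      field_simp; ring
    rw [h5]
    linarith
  have hc : 0 < (1 - 2 * ε * δ * τ * ρ) / (2 * τ) := div_pos (by linarith) (by linarith)
  refine ⟨fun y => ?_, fun x hx => ?_⟩
  · have := main y
    have := mul_nonneg hc.le (sq_nonneg (y - p))
    linarith
  · have h1 := main x
    have h2 := hx p
    by_contra hne
    have h3 : 0 < (x - p) ^ 2 := by
      have := sub_ne_zero.2 hne
      positivity
    have := mul_pos hc h3
    linarith

/-- For `0 < δ < 1`, `ε > 0`, `τ, ρ > 0` with `2εδτρ < 1` and `x₀ ≥ 0`,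
the function `x ↦ (x − x₀)²/(2τ) + ρ φ(|x|)` (with `φ` the semi-convex potential above)
has the unique minimizer `0` if `0 ≤ x₀ ≤ τρ`; `(x₀ − τρ)/(1 − 2εδτρ)` if
`τρ < x₀ ≤ 1/(2ε) + τρ(1−δ)`; and `x₀ − τρ(1−δ)` if `x₀ > 1/(2ε) + τρ(1−δ)`. -/
theorem stmt12 (ε δ : ℝ) (hδ0 : 0 < δ) (hδ1 : δ < 1) (hε : 0 < ε)
    (τ ρ : ℝ) (hτ : 0 < τ) (hρ : 0 < ρ) (hsmall : 2 * ε * δ * τ * ρ < 1)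
    (x₀ : ℝ) (hx₀ : 0 ≤ x₀) :
    (∀ y : ℝ,
      ((if x₀ ≤ τ * ρ then (0 : ℝ)
        else if x₀ ≤ 1 / (2 * ε) + τ * ρ * (1 - δ) then (x₀ - τ * ρ) / (1 - 2 * ε * δ * τ * ρ)
        else x₀ - τ * ρ * (1 - δ)) - x₀) ^ 2 / (2 * τ) +
          ρ * phiSC ε δ |if x₀ ≤ τ * ρ then (0 : ℝ)
            else if x₀ ≤ 1 / (2 * ε) + τ * ρ * (1 - δ) then
              (x₀ - τ * ρ) / (1 - 2 * ε * δ * τ * ρ)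
            else x₀ - τ * ρ * (1 - δ)| ≤
        (y - x₀) ^ 2 / (2 * τ) + ρ * phiSC ε δ |y|) ∧
    (∀ x : ℝ,
      (∀ y : ℝ,
        (x - x₀) ^ 2 / (2 * τ) + ρ * phiSC ε δ |x| ≤
          (y - x₀) ^ 2 / (2 * τ) + ρ * phiSC ε δ |y|) →
      x = if x₀ ≤ τ * ρ then (0 : ℝ)
        else if x₀ ≤ 1 / (2 * ε) + τ * ρ * (1 - δ) then (x₀ - τ * ρ) / (1 - 2 * ε * δ * τ * ρ)
        else x₀ - τ * ρ * (1 - δ)) := by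
  have ha : 0 < 1 / (2 * ε) := by positivity
  have hτρ : 0 < τ * ρ := by positivity
  by_cases h1 : x₀ ≤ τ * ρ
  · simp only [if_pos h1]
    refine key ε δ τ ρ x₀ 0 _ hδ0 hε hτ hρ hsmall le_rfl
      (fun t => phi_lo ε δ 0 t hδ0 hε ha.le) (fun y => ?_)
    nlinarith [mul_le_mul_of_nonneg_right h1 (abs_nonneg y),
      mul_le_mul_of_nonneg_left (le_abs_self y) hx₀]
  by_cases h2 : x₀ ≤ 1 / (2 * ε) + τ * ρ * (1 - δ)
  · simp only [if_neg h1, if_pos h2]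
    have hd : 0 < 1 - 2 * ε * δ * τ * ρ := by linarith
    have hp : 0 ≤ (x₀ - τ * ρ) / (1 - 2 * ε * δ * τ * ρ) := div_nonneg (by linarith) hd.le
    have hpe : (x₀ - τ * ρ) / (1 - 2 * ε * δ * τ * ρ) * (1 - 2 * ε * δ * τ * ρ) = x₀ - τ * ρ :=
      div_mul_cancel₀ _ hd.ne'
    have hpa : (x₀ - τ * ρ) / (1 - 2 * ε * δ * τ * ρ) ≤ 1 / (2 * ε) := by
      rw [div_le_iff₀ hd]
      have : 1 / (2 * ε) * (1 - 2 * ε * δ * τ * ρ) = 1 / (2 * ε) - τ * ρ * δ := by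
        field_simp
      rw [this]; linarith
    generalize (x₀ - τ * ρ) / (1 - 2 * ε * δ * τ * ρ) = p at *
    refine key ε δ τ ρ x₀ p _ hδ0 hε hτ hρ hsmall hp
      (fun t => phi_lo ε δ p t hδ0 hε hpa) (fun y => ?_)
    have hg : 0 ≤ 1 - 2 * ε * δ * p := by
      have : p * (2 * ε) ≤ 1 := (le_div_iff₀ (by positivity)).1 hpa
      nlinarith
    have e : p - x₀ = -(τ * ρ * (1 - 2 * ε * δ * p)) := by linarith
    rw [e]
    have := mul_nonneg (mul_nonneg hτρ.le hg) (sub_nonneg.2 (le_abs_self y))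
    linarith
  · simp only [if_neg h1, if_neg h2]
    have hpa : 1 / (2 * ε) < x₀ - τ * ρ * (1 - δ) := by linarith
    refine key ε δ τ ρ x₀ _ _ hδ0 hε hτ hρ hsmall (by linarith)
      (fun t => phi_hi ε δ _ t hδ0 hε hpa) (fun y => ?_)
    have := mul_nonneg (mul_nonneg hτρ.le (sub_nonneg.2 hδ1.le)) (sub_nonneg.2 (le_abs_self y))
    linarith
end

section
/- Fix parameters 0 < δ < 1 and ε > 0 and define φ : [0,∞) → [0,∞) by φ(x) = x − εδx² for 0 ≤ x ≤ 1/(2ε) and φ(x) = (1−δ)x + δ/(4ε) for x > 1/(2ε). Let ρ, τ > 0 with τ ≤ 1/(2εδρ). Then the function x ↦ x²/(2τ) + ρφ(x) is convex on [0,∞). -/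
/-- For `0 < δ < 1`, `ε > 0` and `ρ, τ > 0` with `τ ≤ 1/(2εδρ)`, the
function `x ↦ x²/(2τ) + ρ φ(x)` (with `φ` the semi-convex potential above) is convex
on `[0,∞)`. -/
theorem stmt13 (ε δ : ℝ) (hδ0 : 0 < δ) (hδ1 : δ < 1) (hε : 0 < ε)
    (ρ τ : ℝ) (hρ : 0 < ρ) (hτ : 0 < τ) (hτle : τ ≤ 1 / (2 * ε * δ * ρ)) :
    ConvexOn ℝ (Set.Ici 0) (fun x => x ^ 2 / (2 * τ) + ρ * phiSC ε δ x) := by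
  have hk : 0 ≤ 1 / (2 * τ) - ρ * ε * δ := by
    have hpos : 0 < 2 * ε * δ * ρ := by positivity
    rw [le_div_iff₀ hpos] at hτle
    rw [sub_nonneg, le_div_iff₀ (by positivity)]
    nlinarith
  have hsq : ConvexOn ℝ (Set.Ici (0:ℝ)) (fun x : ℝ => x ^ 2) := convexOn_pow 2
  have hid : ConvexOn ℝ (Set.Ici (0:ℝ)) (fun x : ℝ => x) := convexOn_id (convex_Ici 0)
  have hmax : ConvexOn ℝ (Set.Ici (0:ℝ)) (fun x : ℝ => max (x - 1 / (2 * ε)) 0) :=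
    (hid.sub (concaveOn_const (1 / (2 * ε)) (convex_Ici 0))).sup (convexOn_const 0 (convex_Ici 0))
  have hmsq : ConvexOn ℝ (Set.Ici (0:ℝ)) (fun x : ℝ => (max (x - 1 / (2 * ε)) 0) ^ 2) :=
    hmax.pow (fun x _ => le_max_right _ _) 2
  have h := ((hsq.smul hk).add (hid.smul hρ.le)).add
    (hmsq.smul (by positivity : 0 ≤ ρ * ε * δ))
  refine h.congr ?_
  intro x _
  simp only [Pi.add_apply, smul_eq_mul, phiSC]
  split_ifs with hx
  · rw [max_eq_right (by linarith)]
    ring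
  · rw [max_eq_left (by linarith)]
    field_simp
    ring
end

section
/- Let (X, μ) be a measure space, 1 < q < ∞, and write L^q = L^q(X, μ). Let Y be a real Banach space and A : L^q → Y a bounded linear operator. Let D : Y → [0,∞] be convex and (strongly) lower semicontinuous. Let N : L^q → [0,∞] be convex and (strongly) lower semicontinuous such that every sequence (v_n) in L^q with sup_n N(v_n) < ∞ admits a subsequence converging weakly in L^q. Let R : L^q → [0,∞] be convex and (strongly) lower semicontinuous, and assume there exist a finite-dimensional subspace U ⊂ L^q, a closed subspace U⊥ ⊂ L^q with L^q = U ⊕ U⊥ (topological direct sum), and a constant B > 0 such that ‖v‖_q ≤ B·R(v) for all v ∈ U⊥ and R(u + w) = R(u) for all u ∈ L^q and w ∈ U. Assume further the coercivity property: for any two sequences (u_n¹)_n ⊂ U and (u_n²)_n ⊂ L^q such that (u_n²)_n is bounded in L^q and (D(A(u_n¹ + u_n²)))_n is bounded, the sequence (‖A u_n¹‖_Y)_n is bounded. Then, for any λ, s₁, s₂ > 0, the minimization problem min over (u,v) ∈ L^q × L^q of λ·D(Au) + s₁·R(u − v) + s₂·N(v) admits a solution. -/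
open MeasureTheory Filter
open scoped ENNReal

theorem aux_strict (q : ℝ) (hq : 1 < q) (a b : ℝ) (hab : a ≠ b) :
    |(a+b)/2| ^ q < (|a|^q+|b|^q)/2 := by
  have h0 : |(a+b)/2| ≤ (|a|+|b|)/2 := by
    rw [abs_div, abs_two]; have := abs_add_le a b; linarith
  by_cases h : |a| = |b|
  · have hb : b = -a := by
      rcases abs_eq_abs.1 h with h | h
      · exact absurd h hab
      · linarith
    have ha : a ≠ 0 := by rintro rfl; simp at hb; exact hab hb.symm
    subst hb
    have : 0 < |a|^q := Real.rpow_pos_of_pos (abs_pos.2 ha) q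
    simp only [add_neg_cancel, zero_div, abs_zero, abs_neg]
    rw [Real.zero_rpow (by linarith)]; linarith
  · have := (strictConvexOn_rpow hq).2 (abs_nonneg a) (abs_nonneg b) h
      (show (0:ℝ) < 1/2 by norm_num) (show (0:ℝ) < 1/2 by norm_num) (by norm_num)
    simp only [smul_eq_mul] at this
    calc |(a+b)/2| ^ q ≤ (1/2*|a|+1/2*|b|)^q :=
          Real.rpow_le_rpow (abs_nonneg _) (by linarith) (by linarith)
      _ < _ := by linarith

theorem aux_le (q : ℝ) (hq : 1 < q) (a b : ℝ) :
    0 ≤ (|a|^q+|b|^q)/2 - |(a+b)/2| ^ q := by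
  by_cases h : a = b
  · subst h; simp
  · linarith [aux_strict q hq a b h]

theorem aux_pt (q : ℝ) (hq : 1 < q) (ε : ℝ) (hε : 0 < ε) :
    ∃ C : ℝ, 0 ≤ C ∧ ∀ a b : ℝ,
      |a-b|^q ≤ ε * (|a|^q+|b|^q) + C * ((|a|^q+|b|^q)/2 - |(a+b)/2|^q) := by
  have hq0 : 0 ≤ q := by linarith
  have key : ∃ C : ℝ, 0 ≤ C ∧ ∀ p : ℝ × ℝ, ‖p‖ = 1 → ε ≤ |p.1-p.2|^q →
      |p.1-p.2|^q ≤ C * ((|p.1|^q+|p.2|^q)/2 - |(p.1+p.2)/2|^q) := by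
    set S : Set (ℝ × ℝ) := Metric.sphere 0 1 ∩ {p | ε ≤ |p.1-p.2|^q} with hS
    have hc1 : Continuous fun p : ℝ × ℝ => |p.1-p.2|^q :=
      Continuous.rpow_const (by fun_prop) (fun _ => Or.inr hq0)
    have hc2 : Continuous fun p : ℝ × ℝ => (|p.1|^q+|p.2|^q)/2 - |(p.1+p.2)/2|^q := by
      have h1 : Continuous fun p : ℝ × ℝ => |p.1|^q :=
        Continuous.rpow_const (by fun_prop) (fun _ => Or.inr hq0)
      have h2 : Continuous fun p : ℝ × ℝ => |p.2|^q :=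
        Continuous.rpow_const (by fun_prop) (fun _ => Or.inr hq0)
      have h3 : Continuous fun p : ℝ × ℝ => |(p.1+p.2)/2|^q :=
        Continuous.rpow_const (by fun_prop) (fun _ => Or.inr hq0)
      exact ((h1.add h2).div_const 2).sub h3
    have hSc : IsCompact S :=
      (isCompact_sphere 0 1).inter_right (isClosed_le continuous_const hc1)
    have hpos : ∀ p ∈ S, 0 < (|p.1|^q+|p.2|^q)/2 - |(p.1+p.2)/2|^q := by
      intro p hp
      have : p.1 ≠ p.2 := by
        intro h
        have := hp.2
        simp only [Set.mem_ofPred_eq, h, sub_self, abs_zero] at this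
        rw [Real.zero_rpow (by linarith)] at this; linarith
      linarith [aux_strict q hq _ _ this]
    obtain ⟨C, hC⟩ := (hSc.bddAbove_image (f := fun p : ℝ × ℝ =>
      |p.1-p.2|^q / ((|p.1|^q+|p.2|^q)/2 - |(p.1+p.2)/2|^q))
      (hc1.continuousOn.div hc2.continuousOn (fun p hp => (hpos p hp).ne')))
    refine ⟨max C 0, le_max_right _ _, fun p hp1 hp2 => ?_⟩
    have hp : p ∈ S := ⟨by simpa using hp1, hp2⟩
    have := hC (Set.mem_image_of_mem _ hp)
    have h3 := (div_le_iff₀ (hpos p hp)).1 (this.trans (le_max_left C 0))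
    exact h3
  obtain ⟨C, hC0, hC⟩ := key
  refine ⟨C, hC0, fun a b => ?_⟩
  have one : ∀ p : ℝ × ℝ, ‖p‖ = 1 →
      |p.1-p.2|^q ≤ ε * (|p.1|^q+|p.2|^q) + C * ((|p.1|^q+|p.2|^q)/2 - |(p.1+p.2)/2|^q) := by
    intro p hp
    have n1 := Real.rpow_nonneg (abs_nonneg p.1) q
    have n2 := Real.rpow_nonneg (abs_nonneg p.2) q
    rcases le_total ε (|p.1-p.2|^q) with h | h
    · have := hC p hp h
      have : 0 ≤ ε * (|p.1|^q+|p.2|^q) := by positivity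
      linarith
    · have h1 : 1 ≤ |p.1|^q+|p.2|^q := by
        rw [Prod.norm_def] at hp
        simp only [Real.norm_eq_abs] at hp
        rcases max_choice |p.1| |p.2| with h | h <;> rw [h] at hp <;> rw [hp, Real.one_rpow] <;>
          linarith
      have := mul_nonneg hC0 (aux_le q hq p.1 p.2)
      nlinarith
  by_cases h0 : ((a,b) : ℝ×ℝ) = 0
  · obtain ⟨rfl, rfl⟩ := Prod.mk.inj h0
    simp [Real.zero_rpow (show q ≠ 0 by linarith)]
  · set r := ‖((a,b):ℝ×ℝ)‖ with hr
    have hrp : 0 < r := norm_pos_iff.2 h0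
    have := one (r⁻¹ • (a,b)) (by rw [norm_smul, norm_inv, norm_norm, ← hr]; field_simp)
    simp only [Prod.smul_fst, Prod.smul_snd, smul_eq_mul] at this
    have sc : ∀ x : ℝ, |r⁻¹ * x|^q = (r⁻¹)^q * |x|^q := fun x => by
      rw [abs_mul, abs_of_pos (inv_pos.2 hrp), Real.mul_rpow (inv_pos.2 hrp).le (abs_nonneg _)]
    rw [← mul_sub, ← mul_add, mul_div_assoc, sc, sc, sc, sc] at this
    have hp : 0 < (r⁻¹)^q := Real.rpow_pos_of_pos (inv_pos.2 hrp) q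
    refine le_of_mul_le_mul_left ?_ hp
    linarith

theorem aux_int {X : Type*} [MeasurableSpace X] (μ : Measure X)
    (q : ℝ) (hq : 1 < q) (f : Lp ℝ (ENNReal.ofReal q) μ) :
    Integrable (fun x => |f x|^q) μ ∧ ‖f‖^q = ∫ x, |f x|^q ∂μ := by
  have hq0 : 0 < q := by linarith
  have hm := Lp.memLp f
  have h0 : ENNReal.ofReal q ≠ 0 := by simpa using hq0
  have ht : ENNReal.ofReal q ≠ ⊤ := ENNReal.ofReal_ne_top
  have hr : (ENNReal.ofReal q).toReal = q := ENNReal.toReal_ofReal hq0.le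
  have hi := hm.integrable_norm_rpow h0 ht
  rw [hr] at hi
  refine ⟨hi, ?_⟩
  rw [Lp.norm_def, hm.eLpNorm_eq_integral_rpow_norm h0 ht, hr,
    ENNReal.toReal_ofReal (by positivity), ← Real.rpow_mul (by positivity),
    inv_mul_cancel₀ hq0.ne', Real.rpow_one]
  rfl

theorem aux_Lp {X : Type*} [MeasurableSpace X] (μ : Measure X)
    (q : ℝ) (hq : 1 < q) [Fact (1 ≤ ENNReal.ofReal q)] (ε : ℝ) (hε : 0 < ε) :
    ∃ C : ℝ, 0 ≤ C ∧ ∀ f g : Lp ℝ (ENNReal.ofReal q) μ,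
      ‖f-g‖^q ≤ ε * (‖f‖^q+‖g‖^q) + C * ((‖f‖^q+‖g‖^q)/2 - ‖(1/2:ℝ) • (f+g)‖^q) := by
  obtain ⟨C, hC0, hC⟩ := aux_pt q hq ε hε
  refine ⟨C, hC0, fun f g => ?_⟩
  obtain ⟨i1, e1⟩ := aux_int μ q hq f
  obtain ⟨i2, e2⟩ := aux_int μ q hq g
  obtain ⟨i3, e3⟩ := aux_int μ q hq (f-g)
  obtain ⟨i4, e4⟩ := aux_int μ q hq ((1/2:ℝ) • (f+g))
  have j1 : Integrable (fun x => |f x|^q + |g x|^q) μ := i1.add i2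
  have j2 : Integrable (fun x => (|f x|^q + |g x|^q)/2) μ := j1.div_const 2
  have j3 : Integrable (fun x => (|f x|^q + |g x|^q)/2 - |((1/2:ℝ) • (f+g)) x|^q) μ := j2.sub i4
  have j4 : Integrable (fun x => ε * (|f x|^q + |g x|^q)) μ := j1.const_mul ε
  have j5 : Integrable (fun x => C * ((|f x|^q + |g x|^q)/2 - |((1/2:ℝ) • (f+g)) x|^q)) μ :=
    j3.const_mul C
  rw [e1, e2, e3, e4, ← integral_add i1 i2, ← integral_const_mul ε, ← integral_div,
    ← integral_sub j2 i4, ← integral_const_mul C, ← integral_add j4 j5]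
  refine integral_mono_ae i3 (j4.add j5) ?_
  filter_upwards [Lp.coeFn_sub f g, Lp.coeFn_smul (1/2:ℝ) (f+g), Lp.coeFn_add f g] with x h1 h2 h3
  have := hC (f x) (g x)
  simp only [Pi.add_apply, h1, h2, h3, Pi.sub_apply, Pi.smul_apply, Pi.add_apply, smul_eq_mul]
  rw [show 1/2 * (f x + g x) = (f x + g x)/2 by ring]
  exact this

/-- nested bounded closed convex sets in `L^q × L^q` intersect. -/
theorem aux_nested {E : Type*} [NormedAddCommGroup E] [NormedSpace ℝ E] [CompleteSpace E]
    (q : ℝ) (hq : 1 < q)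
    (hE : ∀ ε : ℝ, 0 < ε → ∃ C : ℝ, 0 ≤ C ∧ ∀ f g : E,
      ‖f-g‖^q ≤ ε * (‖f‖^q+‖g‖^q) + C * ((‖f‖^q+‖g‖^q)/2 - ‖(1/2:ℝ) • (f+g)‖^q))
    (S : ℕ → Set (E × E)) (hne : ∀ n, (S n).Nonempty) (hanti : Antitone S)
    (hcl : ∀ n, IsClosed (S n))
    (hmid : ∀ n, ∀ x ∈ S n, ∀ y ∈ S n, (1/2:ℝ) • (x+y) ∈ S n)
    (M : ℝ) (hM : ∀ x ∈ S 0, ‖x‖ ≤ M) : ∃ x, ∀ n, x ∈ S n := by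
  have hq0 : 0 < q := by linarith
  set G : E × E → ℝ := fun x => ‖x.1‖^q + ‖x.2‖^q with hG
  have hG0 : ∀ x, 0 ≤ G x := fun x => by positivity
  have hE' : ∀ ε : ℝ, 0 < ε → ∃ C : ℝ, 0 ≤ C ∧ ∀ x y : E × E,
      G (x-y) ≤ ε * (G x + G y) + C * ((G x + G y)/2 - G ((1/2:ℝ) • (x+y))) := by
    intro ε hε
    obtain ⟨C, h0, h⟩ := hE ε hε
    refine ⟨C, h0, fun x y => ?_⟩
    have h1 := h x.1 y.1
    have h2 := h x.2 y.2
    simp only [hG, Prod.fst_sub, Prod.snd_sub, Prod.smul_fst, Prod.smul_snd, Prod.fst_add,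
      Prod.snd_add]
    linarith
  have hnorm : ∀ x : E × E, ‖x‖^q ≤ G x := by
    intro x
    have n1 := Real.rpow_nonneg (norm_nonneg x.1) q
    have n2 := Real.rpow_nonneg (norm_nonneg x.2) q
    rw [Prod.norm_def]
    rcases max_choice ‖x.1‖ ‖x.2‖ with h | h <;> rw [h] <;> simp only [hG] <;> linarith
  have hM0 : 0 ≤ M := by
    obtain ⟨x, hx⟩ := hne 0
    exact (norm_nonneg x).trans (hM x hx)
  set K := 2 * M^q with hK
  have hGM : ∀ n, ∀ x ∈ S n, G x ≤ K := by
    intro n x hx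
    have hx := hM x (hanti (Nat.zero_le n) hx)
    have h1 := Real.rpow_le_rpow (norm_nonneg _) ((norm_fst_le x).trans hx) hq0.le
    have h2 := Real.rpow_le_rpow (norm_nonneg _) ((norm_snd_le x).trans hx) hq0.le
    simp only [hG]; linarith
  have hK0 : 0 ≤ K := by positivity
  set d : ℕ → ℝ := fun n => sInf (G '' S n) with hd
  have hbb : ∀ n, BddBelow (G '' S n) := fun n => ⟨0, by rintro _ ⟨x, -, rfl⟩; exact hG0 x⟩
  have hdle : ∀ n, ∀ x ∈ S n, d n ≤ G x := fun n x hx => csInf_le (hbb n) ⟨x, hx, rfl⟩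
  have hdm : Monotone d := fun m n h =>
    csInf_le_csInf (hbb m) ((hne n).image G) (Set.image_mono (hanti h))
  have hdb : BddAbove (Set.range d) := ⟨K, by
    rintro _ ⟨n, rfl⟩
    obtain ⟨x, hx⟩ := hne n
    exact (hdle n x hx).trans (hGM n x hx)⟩
  set L := ⨆ n, d n with hL
  have hdL : Tendsto d atTop (nhds L) := tendsto_atTop_ciSup hdm hdb
  have hdleL : ∀ n, d n ≤ L := fun n => le_ciSup hdb n
  have hx : ∀ n : ℕ, ∃ x ∈ S n, G x < d n + 1/((n:ℝ)+1) := by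
    intro n
    obtain ⟨_, ⟨x, hx, rfl⟩, h⟩ := exists_lt_of_csInf_lt ((hne n).image G)
      (show sInf (G '' S n) < d n + 1/((n:ℝ)+1) from lt_add_of_pos_right _ (by positivity))
    exact ⟨x, hx, h⟩
  choose x hxS hxG using hx
  have hcau : CauchySeq x := by
    rw [Metric.cauchySeq_iff']
    intro η hη
    have hηq : 0 < η^q := Real.rpow_pos_of_pos hη q
    obtain ⟨C, hC0, hC⟩ := hE' (η^q / (2 * (2*K+1))) (by positivity)
    have hlim : Tendsto (fun n : ℕ => C * (L - d n + 1/((n:ℝ)+1))) atTop (nhds 0) := by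
      have : Tendsto (fun n : ℕ => C * (L - d n + 1/((n:ℝ)+1))) atTop
          (nhds (C * (L - L + 0))) :=
        ((tendsto_const_nhds.sub hdL).add tendsto_one_div_add_atTop_nhds_zero_nat).const_mul C
      simpa using this
    obtain ⟨N, hN⟩ := (hlim.eventually (gt_mem_nhds (half_pos hηq))).exists
    refine ⟨N, fun n hn => ?_⟩
    have hxN : x n ∈ S N := hanti hn (hxS n)
    have h1 := hC (x n) (x N)
    have h2 := hdle N _ (hmid N _ hxN _ (hxS N))
    have h3 := hxG n
    have h4 := hxG N
    have h5 : 1/((n:ℝ)+1) ≤ 1/((N:ℝ)+1) := Nat.one_div_le_one_div hn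
    have h6 := hdleL n
    have h6' := hdleL N
    have h7 : (G (x n) + G (x N))/2 - G ((1/2:ℝ) • (x n + x N)) ≤ L - d N + 1/((N:ℝ)+1) := by
      linarith
    have h8 := mul_le_mul_of_nonneg_left h7 hC0
    have h9 : η^q / (2 * (2*K+1)) * (G (x n) + G (x N)) ≤ η^q/2 := by
      have a1 := hGM n _ (hxS n)
      have a2 := hGM N _ (hxS N)
      calc η^q / (2 * (2*K+1)) * (G (x n) + G (x N)) ≤ η^q / (2 * (2*K+1)) * (2*K+1) := by
            exact mul_le_mul_of_nonneg_left (by linarith) (by positivity)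
        _ = η^q/2 := by field_simp
    have h10 : ‖x n - x N‖^q < η^q := by
      have := hnorm (x n - x N)
      linarith
    rw [dist_eq_norm]
    exact (Real.rpow_lt_rpow_iff (norm_nonneg _) hη.le hq0).1 h10
  obtain ⟨x₀, hx₀⟩ := cauchySeq_tendsto_of_complete hcau
  refine ⟨x₀, fun n => (hcl n).mem_of_tendsto hx₀ ?_⟩
  filter_upwards [eventually_ge_atTop n] with m hm
  exact hanti hm (hxS m)

theorem aux_half (F : ℝ≥0∞) (a b c : ℝ≥0∞)
    (h : F ≤ ENNReal.ofReal (1/2) * a + ENNReal.ofReal (1 - 1/2) * b)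
    (ha : a ≤ c) (hb : b ≤ c) : F ≤ c := by
  refine h.trans ?_
  calc _ ≤ ENNReal.ofReal (1/2) * c + ENNReal.ofReal (1 - 1/2) * c := by gcongr
    _ = c := by
      rw [← add_mul, ← ENNReal.ofReal_add (by norm_num) (by norm_num)]; norm_num

theorem aux_bdd {E : Type*} [NormedAddCommGroup E] [NormedSpace ℝ E]
    (v : ℕ → E) (v₀ : E)
    (h : ∀ f : E →L[ℝ] ℝ, Tendsto (fun n => f (v n)) atTop (nhds (f v₀))) :
    ∃ M : ℝ, ∀ n, ‖v n‖ ≤ M := by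
  obtain ⟨M, hM⟩ := banach_steinhaus
    (g := fun n => NormedSpace.inclusionInDoubleDualLi (E := E) ℝ (v n)) (fun f => by
      obtain ⟨C, hC⟩ := (h f).norm.bddAbove_range
      exact ⟨C, fun n => hC ⟨n, rfl⟩⟩)
  exact ⟨M, fun n => by
    have := hM n
    rwa [LinearIsometry.norm_map] at this⟩

theorem aux_main {E : Type*} [NormedAddCommGroup E] [NormedSpace ℝ E] [CompleteSpace E]
    (q : ℝ) (hq : 1 < q)
    (hE : ∀ ε : ℝ, 0 < ε → ∃ C : ℝ, 0 ≤ C ∧ ∀ f g : E,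
      ‖f-g‖^q ≤ ε * (‖f‖^q+‖g‖^q) + C * ((‖f‖^q+‖g‖^q)/2 - ‖(1/2:ℝ) • (f+g)‖^q))
    {Y : Type*} [NormedAddCommGroup Y] [NormedSpace ℝ Y]
    (A : E →L[ℝ] Y)
    (D : Y → ℝ≥0∞)
    (hDconv : ∀ y₁ y₂ : Y, ∀ t : ℝ, 0 ≤ t → t ≤ 1 →
      D (t • y₁ + (1 - t) • y₂) ≤ ENNReal.ofReal t * D y₁ + ENNReal.ofReal (1 - t) * D y₂)
    (hDlsc : LowerSemicontinuous D)
    (N : E → ℝ≥0∞)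
    (hNconv : ∀ v₁ v₂ : E, ∀ t : ℝ, 0 ≤ t → t ≤ 1 →
      N (t • v₁ + (1 - t) • v₂) ≤ ENNReal.ofReal t * N v₁ + ENNReal.ofReal (1 - t) * N v₂)
    (hNlsc : LowerSemicontinuous N)
    (hNcpt : ∀ v : ℕ → E,
      (∃ C : ℝ≥0∞, C ≠ ⊤ ∧ ∀ n, N (v n) ≤ C) →
      ∃ ψ : ℕ → ℕ, StrictMono ψ ∧ ∃ v₀ : E,
        ∀ f : E →L[ℝ] ℝ,
          Tendsto (fun n => f (v (ψ n))) atTop (nhds (f v₀)))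
    (R : E → ℝ≥0∞)
    (hRconv : ∀ v₁ v₂ : E, ∀ t : ℝ, 0 ≤ t → t ≤ 1 →
      R (t • v₁ + (1 - t) • v₂) ≤ ENNReal.ofReal t * R v₁ + ENNReal.ofReal (1 - t) * R v₂)
    (hRlsc : LowerSemicontinuous R)
    (U Uc : Submodule ℝ E)
    (hUfin : FiniteDimensional ℝ U)
    (hUcclosed : IsClosed (Uc : Set E))
    (hcompl : IsCompl U Uc)
    (B : ℝ) (hB : 0 < B)
    (hRcoerc : ∀ v ∈ Uc, ENNReal.ofReal ‖v‖ ≤ ENNReal.ofReal B * R v)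
    (hRinv : ∀ u : E, ∀ w ∈ U, R (u + w) = R u)
    (hDcoerc : ∀ u₁ u₂ : ℕ → E,
      (∀ n, u₁ n ∈ U) → (∃ M : ℝ, ∀ n, ‖u₂ n‖ ≤ M) →
      (∃ C : ℝ≥0∞, C ≠ ⊤ ∧ ∀ n, D (A (u₁ n + u₂ n)) ≤ C) →
      ∃ M' : ℝ, ∀ n, ‖A (u₁ n)‖ ≤ M')
    (lam s₁ s₂ : ℝ) (hlam : 0 < lam) (hs₁ : 0 < s₁) (hs₂ : 0 < s₂) :
    ∃ u v : E,
      ∀ u' v' : E,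
        ENNReal.ofReal lam * D (A u) + ENNReal.ofReal s₁ * R (u - v) +
            ENNReal.ofReal s₂ * N v ≤
          ENNReal.ofReal lam * D (A u') + ENNReal.ofReal s₁ * R (u' - v') +
            ENNReal.ofReal s₂ * N v' := by
  set F : E × E → ℝ≥0∞ := fun x => ENNReal.ofReal lam * D (A x.1) +
    ENNReal.ofReal s₁ * R (x.1 - x.2) + ENNReal.ofReal s₂ * N x.2 with hF
  suffices h : ∃ x, ∀ y, F x ≤ F y by
    obtain ⟨x, hx⟩ := h
    exact ⟨x.1, x.2, fun u v => hx (u, v)⟩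
  set m := ⨅ y, F y with hm
  suffices h : ∃ x, F x ≤ m by
    obtain ⟨x, hx⟩ := h
    exact ⟨x, fun y => hx.trans (iInf_le F y)⟩
  by_cases hmt : m = ⊤
  · exact ⟨0, hmt ▸ le_top⟩
  -- lower semicontinuity and convexity of F
  have hmul : ∀ c : ℝ, ∀ g : E × E → ℝ≥0∞, LowerSemicontinuous g →
      LowerSemicontinuous fun x => ENNReal.ofReal c * g x := fun c g hg =>
    (ENNReal.continuous_const_mul ENNReal.ofReal_ne_top).comp_lowerSemicontinuous hg
      (fun a b h => mul_le_mul_right h _)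
  have hFlsc : LowerSemicontinuous F := by
    refine ((hmul _ _ ?_).add (hmul _ _ ?_)).add (hmul _ _ ?_)
    · exact hDlsc.comp (A.continuous.comp continuous_fst)
    · exact hRlsc.comp (continuous_fst.sub continuous_snd)
    · exact hNlsc.comp continuous_snd
  have hFconv : ∀ x y, F ((1/2:ℝ) • (x+y)) ≤
      ENNReal.ofReal (1/2) * F x + ENNReal.ofReal (1 - 1/2) * F y := by
    intro x y
    have e : (1/2:ℝ) • (x+y) = (1/2:ℝ) • x + (1-1/2:ℝ) • y := by
      rw [smul_add]; norm_num
    rw [e]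
    have h1 := hDconv (A x.1) (A y.1) (1/2) (by norm_num) (by norm_num)
    have h2 := hRconv (x.1-x.2) (y.1-y.2) (1/2) (by norm_num) (by norm_num)
    have h3 := hNconv x.2 y.2 (1/2) (by norm_num) (by norm_num)
    simp only [hF, Prod.fst_add, Prod.snd_add, Prod.smul_fst, Prod.smul_snd, map_add, map_smul]
    have e2 : (1/2:ℝ) • x.1 + (1-1/2:ℝ) • y.1 - ((1/2:ℝ) • x.2 + (1-1/2:ℝ) • y.2) =
      (1/2:ℝ) • (x.1-x.2) + (1-1/2:ℝ) • (y.1-y.2) := by module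
    rw [e2]
    refine (add_le_add (add_le_add (mul_le_mul_right h1 _) (mul_le_mul_right h2 _))
      (mul_le_mul_right h3 _)).trans (le_of_eq ?_)
    ring
  -- projection
  have hUcl : IsClosed (U : Set E) := U.closed_of_finiteDimensional
  set π : E →L[ℝ] U := U.linearProjOfClosedCompl Uc hcompl hUcl hUcclosed with hπ
  have hπU : ∀ u : U, π (u : E) = u := fun u => by
    exact Submodule.projectionOnto_apply_left hcompl u
  have hπc : ∀ x : E, x - π x ∈ Uc := fun x => by
    rw [← Submodule.ker_projectionOnto (p := U) (q := Uc) hcompl, LinearMap.mem_ker]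
    have := hπU (π x)
    have h2 : π (x - π x) = 0 := by rw [map_sub, this, sub_self]
    exact h2
  set T : U →ₗ[ℝ] Y := A.toLinearMap ∘ₗ U.subtype with hT
  obtain ⟨Z, hZ⟩ := Submodule.exists_isCompl (LinearMap.ker T)
  have hZcl : IsClosed (Z : Set U) := Z.closed_of_finiteDimensional
  set S : ℕ → Set (E × E) := fun n => {x | π x.1 ∈ Z} ∩ {x | F x ≤ m + ((n:ℝ≥0∞)+1)⁻¹} with hS
  have hpos : ∀ n : ℕ, ((n:ℝ≥0∞)+1)⁻¹ ≠ 0 := fun n => by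
    simp
  have hfin : m + (((0:ℕ):ℝ≥0∞)+1)⁻¹ ≠ ⊤ := by simp [hmt]
  have hne : ∀ n, (S n).Nonempty := by
    intro n
    obtain ⟨y, hy⟩ := iInf_lt_iff.1 (show ⨅ y, F y < m + ((n:ℝ≥0∞)+1)⁻¹ from ENNReal.lt_add_right hmt (hpos n))
    obtain ⟨k, hk, z, hz, hkz⟩ := Submodule.mem_sup.1
      (show π y.1 ∈ LinearMap.ker T ⊔ Z by rw [hZ.sup_eq_top]; trivial)
    refine ⟨(y.1 - k, y.2), ?_, ?_⟩
    · simp only [Set.mem_ofPred_eq, map_sub, hπU, ← hkz]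
      simpa using hz
    · have hk' : A (k:E) = 0 := hk
      have e : F (y.1 - k, y.2) = F y := by
        simp only [hF, map_sub, hk', sub_zero]
        have := hRinv (y.1-y.2) (-k) (U.neg_mem k.2)
        rw [show y.1 - (k:E) - y.2 = y.1 - y.2 + -k by abel, this]
      simp only [Set.mem_ofPred_eq, e]
      exact hy.le
  have hanti : Antitone S := by
    intro a b hab x hx
    refine ⟨hx.1, le_trans (show F x ≤ m + ((b:ℝ≥0∞)+1)⁻¹ from hx.2) ?_⟩
    gcongr
  have hcl : ∀ n, IsClosed (S n) := fun n =>
    (hZcl.preimage (π.continuous.comp continuous_fst)).inter (hFlsc.isClosed_preimage _)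
  have hmid : ∀ n, ∀ x ∈ S n, ∀ y ∈ S n, (1/2:ℝ) • (x+y) ∈ S n := by
    intro n x hx y hy
    refine ⟨?_, aux_half _ _ _ _ (hFconv x y) hx.2 hy.2⟩
    have h1 : π x.1 ∈ Z := hx.1
    have h2 : π y.1 ∈ Z := hy.1
    simp only [Set.mem_ofPred_eq, Prod.smul_fst, Prod.fst_add, map_smul, map_add]
    exact Z.smul_mem _ (Z.add_mem h1 h2)
  -- boundedness
  set c := m + (((0:ℕ):ℝ≥0∞)+1)⁻¹ with hc
  have hdiv : ∀ s : ℝ, 0 < s → ∀ a : ℝ≥0∞, ENNReal.ofReal s * a ≤ c →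
      a ≤ (ENNReal.ofReal s)⁻¹ * c := by
    intro s hs a h
    have h0 : ENNReal.ofReal s ≠ 0 := by simpa using hs
    calc a = (ENNReal.ofReal s)⁻¹ * (ENNReal.ofReal s * a) := by
          rw [← mul_assoc, ENNReal.inv_mul_cancel h0 ENNReal.ofReal_ne_top, one_mul]
      _ ≤ _ := by gcongr
  have hdt : ∀ s : ℝ, 0 < s → (ENNReal.ofReal s)⁻¹ * c ≠ ⊤ := by
    intro s hs
    have h0 : ENNReal.ofReal s ≠ 0 := by simpa using hs
    exact ENNReal.mul_ne_top (ENNReal.inv_ne_top.2 h0) hfin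
  have bD : ∀ x ∈ S 0, D (A x.1) ≤ (ENNReal.ofReal lam)⁻¹ * c := fun x hx =>
    hdiv _ hlam _ ((le_self_add.trans le_self_add).trans hx.2)
  have bR : ∀ x ∈ S 0, R (x.1-x.2) ≤ (ENNReal.ofReal s₁)⁻¹ * c := fun x hx =>
    hdiv _ hs₁ _ ((le_add_self.trans le_self_add).trans hx.2)
  have bN : ∀ x ∈ S 0, N x.2 ≤ (ENNReal.ofReal s₂)⁻¹ * c := fun x hx =>
    hdiv _ hs₂ _ (le_add_self.trans hx.2)
  have b1 : ∃ M, ∀ x ∈ S 0, ‖x.2‖ ≤ M := by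
    by_contra! hcon
    choose x hx hxn using fun n : ℕ => hcon n
    obtain ⟨ψ, hψ, v₀, hv⟩ := hNcpt (fun n => (x n).2) ⟨_, hdt s₂ hs₂, fun n => bN _ (hx n)⟩
    obtain ⟨M, hM⟩ := aux_bdd _ v₀ hv
    obtain ⟨n, hn⟩ := exists_nat_ge M
    have h1 := hM n
    have h2 := hxn (ψ n)
    have h3 : (n:ℝ) ≤ ψ n := by exact_mod_cast hψ.le_apply
    linarith
  obtain ⟨M1, hM1⟩ := b1
  -- bound on the Uc component
  have b2 : ∃ M, ∀ x ∈ S 0, ‖x.1 - π x.1‖ ≤ M := by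
    set r := ENNReal.ofReal B * ((ENNReal.ofReal s₁)⁻¹ * c) with hr
    have hrt : r ≠ ⊤ := ENNReal.mul_ne_top ENNReal.ofReal_ne_top (hdt s₁ hs₁)
    refine ⟨r.toReal + (M1 + ‖π‖ * M1), fun x hx => ?_⟩
    set w := x.1 - x.2 with hw
    have h1 := hRcoerc _ (hπc w)
    have h2 : R (w - π w) = R w := by
      rw [sub_eq_add_neg]; exact hRinv w _ (U.neg_mem (π w).2)
    rw [h2] at h1
    have h3 : ENNReal.ofReal ‖w - π w‖ ≤ r := h1.trans (mul_le_mul_right (bR x hx) _)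
    have h4 : ‖w - π w‖ ≤ r.toReal := (ENNReal.ofReal_le_iff_le_toReal hrt).1 h3
    have h5 : x.1 - (π x.1 : E) = (w - π w) + (x.2 - π x.2) := by
      rw [hw, map_sub]; push_cast; abel
    have h6 : ‖(π x.2 : E)‖ ≤ ‖π‖ * ‖x.2‖ := π.le_opNorm x.2
    have h7 := hM1 x hx
    have h8 : ‖π‖ * ‖x.2‖ ≤ ‖π‖ * M1 := by gcongr
    rw [h5]
    have := norm_add_le (w - (π w:E)) (x.2 - π x.2)
    have := norm_sub_le x.2 (π x.2 : E)
    linarith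
  obtain ⟨M2, hM2⟩ := b2
  have b3 : ∃ M, ∀ x ∈ S 0, ‖A (π x.1)‖ ≤ M := by
    by_contra! hcon
    choose x hx hxn using fun n : ℕ => hcon n
    obtain ⟨M, hM⟩ := hDcoerc (fun n => π (x n).1) (fun n => (x n).1 - π (x n).1)
      (fun n => (π (x n).1).2) ⟨M2, fun n => hM2 _ (hx n)⟩
      ⟨_, hdt lam hlam, fun n => by simpa using bD _ (hx n)⟩
    obtain ⟨n, hn⟩ := exists_nat_ge M
    have h1 := hM n
    have h2 := hxn n
    linarith
  obtain ⟨M3, hM3⟩ := b3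
  have hinj : LinearMap.ker (T ∘ₗ Z.subtype) = ⊥ := by
    rw [LinearMap.ker_eq_bot']
    intro z hz
    have : (z : U) ∈ LinearMap.ker T ⊓ Z := ⟨hz, z.2⟩
    rw [hZ.inf_eq_bot] at this
    exact Subtype.ext this
  obtain ⟨k, -, hk⟩ := LinearMap.exists_antilipschitzWith (T ∘ₗ Z.subtype) hinj
  have hbound : ∀ x ∈ S 0, ‖x‖ ≤ max (M2 + k * M3) M1 := by
    intro x hx
    have hz : π x.1 ∈ Z := hx.1
    have h1 := hk.le_mul_norm_sub (⟨π x.1, hz⟩ : Z) 0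
    rw [add_zero, map_zero, add_zero, norm_neg, norm_neg] at h1
    have h2 : ‖(π x.1 : E)‖ ≤ k * ‖A (π x.1)‖ := h1
    have h3 : (k:ℝ) * ‖A (π x.1)‖ ≤ k * M3 := by
      have := hM3 x hx
      gcongr
    have h4 := hM2 x hx
    have h5 := norm_add_le (x.1 - (π x.1 : E)) (π x.1)
    rw [sub_add_cancel] at h5
    rw [Prod.norm_def]
    exact max_le_max (by linarith) (hM1 x hx)
  obtain ⟨x, hx⟩ := aux_nested q hq hE S hne hanti hcl hmid _ hbound
  refine ⟨x, ?_⟩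
  have hlim : Tendsto (fun n : ℕ => m + ((n:ℝ≥0∞)+1)⁻¹) atTop (nhds (m + 0)) := by
    refine tendsto_const_nhds.add ?_
    have := (tendsto_add_atTop_iff_nat 1).2 ENNReal.tendsto_inv_nat_nhds_zero
    simpa using this
  rw [add_zero] at hlim
  exact ge_of_tendsto' hlim fun n => (hx n).2



/-- Existence of minimizers for the cartoon–texture variational problem
`min_{(u,v)} λ D(Au) + s₁ R(u − v) + s₂ N(v)` over `L^q × L^q` (`1 < q < ∞`), where:
`A : L^q → Y` is bounded linear into a Banach space; `D : Y → [0,∞]` is convex and lower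
semicontinuous; `N : L^q → [0,∞]` is convex, lower semicontinuous and its sublevel sets are
weakly sequentially precompact; `R : L^q → [0,∞]` is convex, lower semicontinuous, invariant
under a finite-dimensional subspace `U`, coercive (`‖v‖_q ≤ B R(v)`) on a closed complement
`U⊥`, and `D ∘ A` is coercive on `U` in the stated sense. -/
theorem stmt16 {X : Type*} [MeasurableSpace X] (μ : Measure X)
    (q : ℝ) (hq : 1 < q) [Fact (1 ≤ ENNReal.ofReal q)]
    {Y : Type*} [NormedAddCommGroup Y] [NormedSpace ℝ Y] [CompleteSpace Y]
    (A : Lp ℝ (ENNReal.ofReal q) μ →L[ℝ] Y)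
    (D : Y → ℝ≥0∞)
    (hDconv : ∀ y₁ y₂ : Y, ∀ t : ℝ, 0 ≤ t → t ≤ 1 →
      D (t • y₁ + (1 - t) • y₂) ≤ ENNReal.ofReal t * D y₁ + ENNReal.ofReal (1 - t) * D y₂)
    (hDlsc : LowerSemicontinuous D)
    (N : Lp ℝ (ENNReal.ofReal q) μ → ℝ≥0∞)
    (hNconv : ∀ v₁ v₂ : Lp ℝ (ENNReal.ofReal q) μ, ∀ t : ℝ, 0 ≤ t → t ≤ 1 →
      N (t • v₁ + (1 - t) • v₂) ≤ ENNReal.ofReal t * N v₁ + ENNReal.ofReal (1 - t) * N v₂)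
    (hNlsc : LowerSemicontinuous N)
    (hNcpt : ∀ v : ℕ → Lp ℝ (ENNReal.ofReal q) μ,
      (∃ C : ℝ≥0∞, C ≠ ⊤ ∧ ∀ n, N (v n) ≤ C) →
      ∃ ψ : ℕ → ℕ, StrictMono ψ ∧ ∃ v₀ : Lp ℝ (ENNReal.ofReal q) μ,
        ∀ f : Lp ℝ (ENNReal.ofReal q) μ →L[ℝ] ℝ,
          Tendsto (fun n => f (v (ψ n))) atTop (nhds (f v₀)))
    (R : Lp ℝ (ENNReal.ofReal q) μ → ℝ≥0∞)
    (hRconv : ∀ v₁ v₂ : Lp ℝ (ENNReal.ofReal q) μ, ∀ t : ℝ, 0 ≤ t → t ≤ 1 →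
      R (t • v₁ + (1 - t) • v₂) ≤ ENNReal.ofReal t * R v₁ + ENNReal.ofReal (1 - t) * R v₂)
    (hRlsc : LowerSemicontinuous R)
    (U Uc : Submodule ℝ (Lp ℝ (ENNReal.ofReal q) μ))
    (hUfin : FiniteDimensional ℝ U)
    (hUcclosed : IsClosed (Uc : Set (Lp ℝ (ENNReal.ofReal q) μ)))
    (hcompl : IsCompl U Uc)
    (B : ℝ) (hB : 0 < B)
    (hRcoerc : ∀ v ∈ Uc, ENNReal.ofReal ‖v‖ ≤ ENNReal.ofReal B * R v)
    (hRinv : ∀ u : Lp ℝ (ENNReal.ofReal q) μ, ∀ w ∈ U, R (u + w) = R u)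
    (hDcoerc : ∀ u₁ u₂ : ℕ → Lp ℝ (ENNReal.ofReal q) μ,
      (∀ n, u₁ n ∈ U) → (∃ M : ℝ, ∀ n, ‖u₂ n‖ ≤ M) →
      (∃ C : ℝ≥0∞, C ≠ ⊤ ∧ ∀ n, D (A (u₁ n + u₂ n)) ≤ C) →
      ∃ M' : ℝ, ∀ n, ‖A (u₁ n)‖ ≤ M')
    (lam s₁ s₂ : ℝ) (hlam : 0 < lam) (hs₁ : 0 < s₁) (hs₂ : 0 < s₂) :
    ∃ u v : Lp ℝ (ENNReal.ofReal q) μ,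
      ∀ u' v' : Lp ℝ (ENNReal.ofReal q) μ,
        ENNReal.ofReal lam * D (A u) + ENNReal.ofReal s₁ * R (u - v) +
            ENNReal.ofReal s₂ * N v ≤
          ENNReal.ofReal lam * D (A u') + ENNReal.ofReal s₁ * R (u' - v') +
            ENNReal.ofReal s₂ * N v' := by
  exact aux_main q hq (aux_Lp μ q hq) A D hDconv hDlsc N hNconv hNlsc hNcpt R hRconv hRlsc U Uc hUfin
    hUcclosed hcompl B hB hRcoerc hRinv hDcoerc lam s₁ s₂ hlam hs₁ hs₂
end
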